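/- Let p be an odd prime, let s ∈ ℤ_p with s ≠ 1, and let a ∈ ℚ_p with |a|_p > 1. Then the series on the left converges in ℚ_p and the following identity holds: (2/(s−1))·(ζ_{p,E}(s,a) − ⟨a⟩^{1−s}) + (1/ω_v(a))·(ζ_{p,E}(s+1,a) − ⟨a⟩^{1−(s+1)}) + Σ_{n=2}^∞ [ (∏_{j=1}^{n−1}(s−1+j)) / (n!·ω_v(a)^n) ]·(ζ_{p,E}(s+n,a) − ⟨a⟩^{1−(s+n)}) = (1/(s−1))·(⟨a−1⟩^{1−s} − ⟨a⟩^{1−s}). -/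

import Mathlib

open Filter Topology

noncomputable def teich (p : ℕ) [Fact p.Prime] (u : ℚ_[p]) : ℚ_[p] :=
  limUnder atTop fun n : ℕ => u ^ p ^ n

noncomputable def omegaV (p : ℕ) [Fact p.Prime] (a : ℚ_[p]) : ℚ_[p] :=
  (p : ℚ_[p]) ^ a.valuation * teich p (a * (p : ℚ_[p]) ^ (-a.valuation))

noncomputable def proj (p : ℕ) [Fact p.Prime] (a : ℚ_[p]) : ℚ_[p] :=
  a / omegaV p a

noncomputable def binom (p : ℕ) [Fact p.Prime] (s : ℚ_[p]) (n : ℕ) : ℚ_[p] :=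
  (∏ j ∈ Finset.range n, (s - (j : ℚ_[p]))) / (n.factorial : ℚ_[p])

noncomputable def hpow (p : ℕ) [Fact p.Prime] (a s : ℚ_[p]) : ℚ_[p] :=
  ∑' n : ℕ, binom p s n * (proj p a - 1) ^ n

noncomputable def zetaE (p : ℕ) [Fact p.Prime] (s a : ℚ_[p]) : ℚ_[p] :=
  limUnder atTop fun r : ℕ =>
    ∑ k ∈ Finset.range (p ^ r), (-1 : ℚ_[p]) ^ k * hpow p ((k : ℚ_[p]) + a) (1 - s)

noncomputable def coeffT (p : ℕ) [Fact p.Prime] (s a : ℚ_[p]) (n : ℕ) : ℚ_[p] :=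
  (∏ j ∈ Finset.Icc 1 (n - 1), (s - 1 + (j : ℚ_[p]))) /
    ((n.factorial : ℚ_[p]) * omegaV p a ^ n)

section OneAddPow

variable {p : ℕ} [Fact p.Prime]

lemma binom_coe (z : ℤ_[p]) (n : ℕ) :
    binom p (z : ℚ_[p]) n = ((Ring.choose z n : ℤ_[p]) : ℚ_[p]) := by
  have h := Ring.descPochhammer_eq_factorial_smul_choose z n
  have h2 : (descPochhammer ℤ n).smeval z = ∏ j ∈ Finset.range n, (z - (j : ℤ_[p])) := by
    rw [← Polynomial.aeval_eq_smeval, ← Polynomial.eval_map_algebraMap, descPochhammer_map]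
    exact descPochhammer_eval_eq_prod_range n z
  rw [h2, nsmul_eq_mul] at h
  have h3 := congrArg (fun x : ℤ_[p] => (x : ℚ_[p])) h
  simp only [PadicInt.coe_mul, PadicInt.coe_natCast] at h3
  rw [binom, div_eq_iff (by exact_mod_cast n.factorial_ne_zero), mul_comm, ← h3]
  have h4 := map_prod (PadicInt.Coe.ringHom (p := p)) (fun j : ℕ => z - (j : ℤ_[p])) (Finset.range n)
  exact h4.symm

instance PadicInt.isBoundedSMul_padic : IsBoundedSMul ℤ_[p] ℚ_[p] :=
  .of_norm_smul_le fun r x => by rw [Algebra.smul_def, norm_mul]; rfl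

/-- The character `z ↦ (1 + x) ^ z` of `ℤ_[p]`, for `x` in the open unit disc. -/
noncomputable def oneAddPow (x : ℚ_[p]) (hx : ‖x‖ < 1) : AddChar ℤ_[p] ℚ_[p] :=
  PadicInt.addChar_of_value_at_one x (tendsto_pow_atTop_nhds_zero_iff_norm_lt_one.mpr hx)

lemma norm_binom_coe_le_one (z : ℤ_[p]) (n : ℕ) : ‖binom p (z : ℚ_[p]) n‖ ≤ 1 := by
  rw [binom_coe]
  exact PadicInt.norm_le_one _

lemma hasSum_oneAddPow {x : ℚ_[p]} (hx : ‖x‖ < 1) (z : ℤ_[p]) :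
    HasSum (fun n => binom p (z : ℚ_[p]) n * x ^ n) (oneAddPow x hx z) := by
  have hs : Summable (fun n => binom p (z : ℚ_[p]) n * x ^ n) := by
    refine Summable.of_norm_bounded (summable_geometric_of_lt_one (norm_nonneg x) hx) fun n => ?_
    rw [norm_mul, norm_pow]
    exact mul_le_of_le_one_left (by positivity) (norm_binom_coe_le_one z n)
  have he : oneAddPow x hx z = ∑' n, binom p (z : ℚ_[p]) n * x ^ n := by
    rw [oneAddPow, PadicInt.coe_addChar_of_value_at_one,
      PadicInt.mahlerSeries_apply (tendsto_pow_atTop_nhds_zero_iff_norm_lt_one.mpr hx)]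
    refine tsum_congr fun n => ?_
    rw [binom_coe, mahler_apply, Algebra.smul_def]
    rfl
  rw [he]
  exact hs.hasSum

lemma norm_oneAddPow_le_one {x : ℚ_[p]} (hx : ‖x‖ < 1) (z : ℤ_[p]) : ‖oneAddPow x hx z‖ ≤ 1 := by
  rw [← (hasSum_oneAddPow hx z).tsum_eq]
  refine IsUltrametricDist.norm_tsum_le_of_forall_le fun n => ?_
  rw [norm_mul, norm_pow]
  exact mul_le_one₀ (norm_binom_coe_le_one z n) (by positivity)
    (pow_le_one₀ (norm_nonneg x) hx.le)

lemma norm_pow_sub_pow_le {x y : ℚ_[p]} (hx : ‖x‖ ≤ 1) (hy : ‖y‖ ≤ 1) (n : ℕ) :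
    ‖x ^ n - y ^ n‖ ≤ ‖x - y‖ := by
  obtain ⟨u, rfl⟩ : ∃ u : ℤ_[p], (u : ℚ_[p]) = x := ⟨⟨x, hx⟩, rfl⟩
  obtain ⟨v, rfl⟩ : ∃ v : ℤ_[p], (v : ℚ_[p]) = y := ⟨⟨y, hy⟩, rfl⟩
  obtain ⟨c, hc⟩ := sub_dvd_pow_sub_pow u v n
  have h := congrArg (fun w : ℤ_[p] => (w : ℚ_[p])) hc
  simp only [PadicInt.coe_sub, PadicInt.coe_pow, PadicInt.coe_mul] at h
  rw [h, norm_mul]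
  exact mul_le_of_le_one_right (norm_nonneg _) (PadicInt.norm_le_one c)

lemma norm_oneAddPow_sub_le {x y : ℚ_[p]} (hx : ‖x‖ < 1) (hy : ‖y‖ < 1) (z : ℤ_[p]) :
    ‖oneAddPow x hx z - oneAddPow y hy z‖ ≤ ‖x - y‖ := by
  rw [← ((hasSum_oneAddPow hx z).sub (hasSum_oneAddPow hy z)).tsum_eq]
  refine IsUltrametricDist.norm_tsum_le_of_forall_le fun n => ?_
  rw [← mul_sub, norm_mul]
  exact (mul_le_of_le_one_left (norm_nonneg _) (norm_binom_coe_le_one z n)).trans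
    (norm_pow_sub_pow_le hx.le hy.le n)

lemma oneAddPow_mul {x y w : ℚ_[p]} (hx : ‖x‖ < 1) (hy : ‖y‖ < 1) (hw : ‖w‖ < 1)
    (h : 1 + w = (1 + x) * (1 + y)) (z : ℤ_[p]) :
    oneAddPow w hw z = oneAddPow x hx z * oneAddPow y hy z := by
  have hc : Continuous (oneAddPow x hx * oneAddPow y hy : AddChar ℤ_[p] ℚ_[p]) := by
    rw [AddChar.coe_mul]
    exact (PadicInt.continuous_addChar_of_value_at_one
      (tendsto_pow_atTop_nhds_zero_iff_norm_lt_one.mpr hx)).mul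
      (PadicInt.continuous_addChar_of_value_at_one
        (tendsto_pow_atTop_nhds_zero_iff_norm_lt_one.mpr hy))
  have := PadicInt.eq_addChar_of_value_at_one
    (tendsto_pow_atTop_nhds_zero_iff_norm_lt_one.mpr hw) hc
    (by rw [AddChar.mul_apply, oneAddPow, oneAddPow, PadicInt.addChar_of_value_at_one_def,
          PadicInt.addChar_of_value_at_one_def, h])
  rw [← AddChar.mul_apply, this]
  rfl

lemma oneAddPow_natCast {x : ℚ_[p]} (hx : ‖x‖ < 1) (n : ℕ) :
    oneAddPow x hx n = (1 + x) ^ n := by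
  rw [← nsmul_one, AddChar.map_nsmul_eq_pow, oneAddPow, PadicInt.addChar_of_value_at_one_def]

lemma oneAddPow_sub_natCast_mul {x : ℚ_[p]} (hx : ‖x‖ < 1) (z : ℤ_[p]) (n : ℕ) :
    oneAddPow x hx (z - n) * (1 + x) ^ n = oneAddPow x hx z := by
  rw [← oneAddPow_natCast hx, ← AddChar.map_add_eq_mul, sub_add_cancel]

end OneAddPow

section Teichmuller

variable {p : ℕ} [Fact p.Prime]

lemma norm_pow_prime_pow_sub_le {u v : ℤ_[p]} (h : ‖u - v‖ < 1) (n : ℕ) :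
    ‖u ^ p ^ n - v ^ p ^ n‖ ≤ (p : ℝ)⁻¹ ^ (n + 1) := by
  have := (PadicInt.norm_le_pow_iff_mem_span_pow _ _).mpr
    (Ideal.mem_span_singleton.mpr (dvd_sub_pow_of_dvd_sub (PadicInt.norm_lt_one_iff_dvd _ |>.mp h) n))
  refine this.trans_eq ?_
  rw [zpow_neg, zpow_natCast, inv_pow]

lemma norm_pow_prime_sub_lt_one (u : ℤ_[p]) : ‖u ^ p - u‖ < 1 := by
  rw [← PadicInt.mem_nonunits, ← IsLocalRing.mem_maximalIdeal, ← PadicInt.ker_toZMod,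
    RingHom.mem_ker, map_sub, map_pow, ZMod.pow_card, sub_self]

lemma inv_prime_lt_one : (p : ℝ)⁻¹ < 1 :=
  inv_lt_one_of_one_lt₀ (by exact_mod_cast (Fact.out : p.Prime).one_lt)

lemma tendsto_teich (u : ℤ_[p]) :
    Tendsto (fun n : ℕ => (u : ℚ_[p]) ^ p ^ n) atTop (𝓝 (teich p u)) := by
  refine CauchySeq.tendsto_limUnder (cauchySeq_of_le_geometric (p : ℝ)⁻¹ (p : ℝ)⁻¹ inv_prime_lt_one
    fun n => ?_)
  have h := norm_pow_prime_pow_sub_le (norm_pow_prime_sub_lt_one u) n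
  rw [dist_comm, dist_eq_norm, ← pow_succ', pow_succ' p n, pow_mul]
  exact_mod_cast h

lemma teich_eq_of_norm_sub_lt_one {u v : ℤ_[p]} (h : ‖u - v‖ < 1) :
    teich p (u : ℚ_[p]) = teich p (v : ℚ_[p]) := by
  rw [← sub_eq_zero]
  refine tendsto_nhds_unique ((tendsto_teich u).sub (tendsto_teich v))
    (squeeze_zero_norm (a := fun n => (p : ℝ)⁻¹ ^ (n + 1)) (fun n => ?_) ?_)
  · exact_mod_cast norm_pow_prime_pow_sub_le h n
  · exact (tendsto_pow_atTop_nhds_zero_of_lt_one (by positivity) inv_prime_lt_one).comp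
      (tendsto_add_atTop_nat 1)

lemma norm_teich_sub_lt_one (u : ℤ_[p]) : ‖teich p (u : ℚ_[p]) - u‖ < 1 := by
  have h (n : ℕ) : ‖(u : ℚ_[p]) ^ p ^ n - u‖ ≤ (p : ℝ)⁻¹ := by
    induction n with
    | zero => simp
    | succ n ih =>
      have h1 := norm_pow_prime_pow_sub_le (norm_pow_prime_sub_lt_one u) n
      have h2 : ‖(u : ℚ_[p]) ^ p ^ (n + 1) - (u : ℚ_[p]) ^ p ^ n‖ ≤ (p : ℝ)⁻¹ := by
        rw [pow_succ' p n, pow_mul]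
        refine le_trans (by exact_mod_cast h1) ?_
        rw [pow_succ]
        exact mul_le_of_le_one_left (by positivity)
          (pow_le_one₀ (by positivity) inv_prime_lt_one.le)
      rw [← sub_add_sub_cancel _ ((u : ℚ_[p]) ^ p ^ n)]
      exact (Padic.nonarchimedean _ _).trans (max_le h2 ih)
  exact (le_of_tendsto ((tendsto_teich u).sub_const _).norm (.of_forall h)).trans_lt
    inv_prime_lt_one

lemma norm_mul_zpow_neg_valuation {a : ℚ_[p]} (ha : a ≠ 0) :
    ‖a * (p : ℚ_[p]) ^ (-a.valuation)‖ = 1 := by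
  have hp : (p : ℝ) ≠ 0 := by exact_mod_cast (Fact.out : p.Prime).ne_zero
  rw [norm_mul, Padic.norm_eq_zpow_neg_valuation ha, Padic.norm_p_zpow, ← zpow_add₀ hp]
  simp

lemma norm_omegaV {a : ℚ_[p]} (ha : a ≠ 0) : ‖omegaV p a‖ = ‖a‖ := by
  have hu := norm_mul_zpow_neg_valuation ha
  have ht : ‖teich p (a * (p : ℚ_[p]) ^ (-a.valuation)) - a * (p : ℚ_[p]) ^ (-a.valuation)‖ <
      ‖a * (p : ℚ_[p]) ^ (-a.valuation)‖ :=
    (norm_teich_sub_lt_one (⟨_, hu.le⟩ : ℤ_[p])).trans_eq hu.symm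
  rw [omegaV, norm_mul, Padic.norm_eq_of_norm_sub_lt_right ht, hu, mul_one, Padic.norm_p_zpow,
    Padic.norm_eq_zpow_neg_valuation ha]

lemma norm_proj_sub_one_lt_one {a : ℚ_[p]} (ha : a ≠ 0) : ‖proj p a - 1‖ < 1 := by
  have hp : (p : ℚ_[p]) ≠ 0 := by exact_mod_cast (Fact.out : p.Prime).ne_zero
  have hu := norm_mul_zpow_neg_valuation ha
  have ht := norm_teich_sub_lt_one (⟨_, hu.le⟩ : ℤ_[p])
  have ho : omegaV p a ≠ 0 := by rw [← norm_ne_zero_iff, norm_omegaV ha]; simpa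
  rw [proj, div_sub_one ho, norm_div, norm_omegaV ha, div_lt_one (by simpa), norm_sub_rev]
  have : omegaV p a - a = (p : ℚ_[p]) ^ a.valuation *
      (teich p (a * (p : ℚ_[p]) ^ (-a.valuation)) - a * (p : ℚ_[p]) ^ (-a.valuation)) := by
    rw [omegaV, mul_sub, mul_left_comm _ a, ← zpow_add₀ hp]
    simp
  rw [this, norm_mul, Padic.norm_p_zpow, Padic.norm_eq_zpow_neg_valuation ha]
  exact mul_lt_of_lt_one_right
    (zpow_pos (by exact_mod_cast (Fact.out : p.Prime).pos) _) ht

lemma omegaV_eq_of_norm_sub_lt {a b : ℚ_[p]} (h : ‖b - a‖ < ‖a‖) :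
    omegaV p b = omegaV p a := by
  have hp : (1 : ℝ) < p := by exact_mod_cast (Fact.out : p.Prime).one_lt
  have ha : a ≠ 0 := norm_pos_iff.mp ((norm_nonneg _).trans_lt h)
  have hn : ‖b‖ = ‖a‖ := Padic.norm_eq_of_norm_sub_lt_right h
  have hb : b ≠ 0 := by rw [← norm_ne_zero_iff, hn]; simpa
  have hv : b.valuation = a.valuation := by
    rw [Padic.norm_eq_zpow_neg_valuation ha, Padic.norm_eq_zpow_neg_valuation hb] at hn
    exact neg_injective (zpow_right_injective₀ (zero_lt_one.trans hp) hp.ne' hn)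
  have hua := norm_mul_zpow_neg_valuation ha
  have hub := norm_mul_zpow_neg_valuation hb
  have := teich_eq_of_norm_sub_lt_one (u := ⟨_, hub.le⟩) (v := ⟨_, hua.le⟩) (by
    change ‖b * (p : ℚ_[p]) ^ (-b.valuation) - a * (p : ℚ_[p]) ^ (-a.valuation)‖ < 1
    rw [hv, ← sub_mul, norm_mul, ← hua, norm_mul]
    have : (p : ℚ_[p]) ^ (-a.valuation) ≠ 0 := zpow_ne_zero _ (by
      exact_mod_cast (Fact.out : p.Prime).ne_zero)
    gcongr)
  change teich p (b * _) = teich p (a * _) at this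
  rw [omegaV, omegaV, this, hv]

end Teichmuller

section AlternatingSums

variable {p : ℕ} [Fact p.Prime]

lemma norm_alternating_sum_sub_le {f : ℕ → ℚ_[p]}
    (hf : ∀ i j : ℕ, ‖f i - f j‖ ≤ ‖(i : ℚ_[p]) - j‖) {M : ℕ} (hM : Odd M) (m : ℕ) :
    ‖∑ k ∈ Finset.range (M * (2 * m + 1)), (-1) ^ k * f k -
      ∑ k ∈ Finset.range M, (-1) ^ k * f k‖ ≤ ‖(M : ℚ_[p])‖ := by
  induction m with
  | zero => simp
  | succ m ih =>
    set N := M * (2 * m + 1) with hN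
    have hstep : ∑ k ∈ Finset.range (M * (2 * (m + 1) + 1)), (-1) ^ k * f k -
        ∑ k ∈ Finset.range N, (-1) ^ k * f k =
        ∑ k ∈ Finset.range M, (-1) ^ (N + k) * (f (N + k) - f (N + M + k)) := by
      have : M * (2 * (m + 1) + 1) = N + M + M := by rw [hN]; ring
      rw [this, Finset.sum_range_add, Finset.sum_range_add, add_assoc, add_sub_cancel_left,
        ← Finset.sum_add_distrib]
      refine Finset.sum_congr rfl fun k _ => ?_
      rw [add_right_comm, pow_add _ (N + k), hM.neg_one_pow]
      ring
    rw [← sub_add_sub_cancel _ (∑ k ∈ Finset.range N, (-1) ^ k * f k), hstep]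
    refine (Padic.nonarchimedean _ _).trans (max_le ?_ ih)
    refine IsUltrametricDist.norm_sum_le_of_forall_le_of_nonneg (norm_nonneg _) fun k _ => ?_
    rw [norm_mul, norm_pow, norm_neg, norm_one, one_pow, one_mul]
    refine (hf _ _).trans_eq ?_
    push_cast
    rw [← norm_neg]
    congr 1
    ring

lemma cauchySeq_alternating_sum (hodd : p ≠ 2) {f : ℕ → ℚ_[p]}
    (hf : ∀ i j : ℕ, ‖f i - f j‖ ≤ ‖(i : ℚ_[p]) - j‖) :
    CauchySeq fun r : ℕ => ∑ k ∈ Finset.range (p ^ r), (-1) ^ k * f k := by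
  have hp : Odd p := (Fact.out : p.Prime).odd_of_ne_two hodd
  obtain ⟨m, hm⟩ := id hp
  refine cauchySeq_of_le_geometric (p : ℝ)⁻¹ 1 inv_prime_lt_one fun r => ?_
  have h := norm_alternating_sum_sub_le hf (hp.pow (n := r)) m
  rw [← hm, ← pow_succ, Nat.cast_pow, norm_pow, Padic.norm_p] at h
  rwa [dist_comm, dist_eq_norm, one_mul]

end AlternatingSums

section Hurwitz

variable {p : ℕ} [Fact p.Prime]

lemma hpow_eq_oneAddPow {a : ℚ_[p]} (ha : a ≠ 0) (z : ℤ_[p]) :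
    hpow p a z = oneAddPow (proj p a - 1) (norm_proj_sub_one_lt_one ha) z :=
  (hasSum_oneAddPow _ z).tsum_eq

lemma norm_hpow_le_one {a : ℚ_[p]} (ha : a ≠ 0) (z : ℤ_[p]) : ‖hpow p a z‖ ≤ 1 := by
  rw [hpow_eq_oneAddPow ha]
  exact norm_oneAddPow_le_one _ z

lemma norm_sub_le_one {x y : ℚ_[p]} (hx : ‖x‖ ≤ 1) (hy : ‖y‖ ≤ 1) : ‖x - y‖ ≤ 1 := by
  rw [sub_eq_add_neg]
  exact (Padic.nonarchimedean x (-y)).trans (max_le hx (by rwa [norm_neg]))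

lemma norm_natCast_le_one (k : ℕ) : ‖(k : ℚ_[p])‖ ≤ 1 := by
  exact_mod_cast PadicInt.norm_le_one (k : ℤ_[p])

lemma norm_add_of_norm_le_one {a t : ℚ_[p]} (ha : 1 < ‖a‖) (ht : ‖t‖ ≤ 1) : ‖t + a‖ = ‖a‖ :=
  Padic.norm_eq_of_norm_sub_lt_right (by rw [add_sub_cancel_right]; exact ht.trans_lt ha)

lemma omegaV_add_of_norm_le_one {a t : ℚ_[p]} (ha : 1 < ‖a‖) (ht : ‖t‖ ≤ 1) :
    omegaV p (t + a) = omegaV p a :=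
  omegaV_eq_of_norm_sub_lt (by rw [add_sub_cancel_right]; exact ht.trans_lt ha)

lemma ne_zero_of_one_lt_norm {a : ℚ_[p]} (ha : 1 < ‖a‖) : a ≠ 0 :=
  norm_pos_iff.mp (zero_lt_one.trans ha)

lemma omegaV_ne_zero {a : ℚ_[p]} (ha : a ≠ 0) : omegaV p a ≠ 0 := by
  rw [← norm_ne_zero_iff, norm_omegaV ha]
  simpa

lemma norm_hpow_add_sub_le {a t u : ℚ_[p]} (ha : 1 < ‖a‖) (ht : ‖t‖ ≤ 1) (hu : ‖u‖ ≤ 1)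
    (z : ℤ_[p]) : ‖hpow p (t + a) z - hpow p (u + a) z‖ ≤ ‖t - u‖ := by
  have hta : t + a ≠ 0 := ne_zero_of_one_lt_norm (by rwa [norm_add_of_norm_le_one ha ht])
  have hua : u + a ≠ 0 := ne_zero_of_one_lt_norm (by rwa [norm_add_of_norm_le_one ha hu])
  rw [hpow_eq_oneAddPow hta, hpow_eq_oneAddPow hua]
  refine (norm_oneAddPow_sub_le _ _ z).trans ?_
  rw [proj, proj, omegaV_add_of_norm_le_one ha ht, omegaV_add_of_norm_le_one ha hu,
    sub_sub_sub_cancel_right, ← sub_div, add_sub_add_right_eq_sub, norm_div,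
    norm_omegaV (ne_zero_of_one_lt_norm ha)]
  exact div_le_self (norm_nonneg _) ha.le

lemma tendsto_zetaE (hodd : p ≠ 2) {a : ℚ_[p]} (ha : 1 < ‖a‖) {s : ℚ_[p]} {z : ℤ_[p]}
    (hz : (z : ℚ_[p]) = 1 - s) :
    Tendsto (fun r : ℕ => ∑ k ∈ Finset.range (p ^ r), (-1) ^ k * hpow p ((k : ℚ_[p]) + a) z)
      atTop (𝓝 (zetaE p s a)) := by
  rw [zetaE, ← hz]
  exact (cauchySeq_alternating_sum hodd fun i j =>
    norm_hpow_add_sub_le ha (norm_natCast_le_one i) (norm_natCast_le_one j) z).tendsto_limUnder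

/-- The binomial expansion of `⟨b - 1⟩ ^ z` in terms of the `⟨b⟩ ^ (z - n)`. -/
lemma hasSum_hpow_sub_one {b : ℚ_[p]} (hb : 1 < ‖b‖) (z : ℤ_[p]) :
    HasSum (fun n : ℕ => binom p (z : ℚ_[p]) n * (-(omegaV p b)⁻¹) ^ n *
      hpow p b ((z - n : ℤ_[p]) : ℚ_[p])) (hpow p (b - 1) z) := by
  have hb0 : b ≠ 0 := ne_zero_of_one_lt_norm hb
  have ho := omegaV_ne_zero hb0
  have hb1n : ‖-1 + b‖ = ‖b‖ := norm_add_of_norm_le_one hb (by simp)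
  have hb1 : b - 1 ≠ 0 := by
    rw [sub_eq_neg_add]
    exact ne_zero_of_one_lt_norm (by rwa [hb1n])
  have hob : omegaV p (b - 1) = omegaV p b := by
    rw [sub_eq_neg_add]
    exact omegaV_add_of_norm_le_one hb (by simp)
  have hx : ‖-b⁻¹‖ < 1 := by
    rw [norm_neg, norm_inv]
    exact inv_lt_one_of_one_lt₀ hb
  have hmul := oneAddPow_mul hx (norm_proj_sub_one_lt_one hb0) (norm_proj_sub_one_lt_one hb1) (by
    rw [proj, proj, hob]
    field_simp
    ring) z
  rw [hpow_eq_oneAddPow hb1, hmul]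
  refine ((hasSum_oneAddPow hx z).mul_right
    (oneAddPow (proj p b - 1) (norm_proj_sub_one_lt_one hb0) z)).congr_fun fun n => ?_
  have hb' : -(omegaV p b)⁻¹ = -b⁻¹ * (1 + (proj p b - 1)) := by
    rw [proj]
    field_simp
    ring
  rw [hpow_eq_oneAddPow hb0, ← oneAddPow_sub_natCast_mul _ z n, hb', mul_pow]
  ring

/-- The terms of the binomial expansion summed against an alternating sign. -/
lemma hasSum_alternating_sum {a : ℚ_[p]} (ha : 1 < ‖a‖) (z : ℤ_[p]) (N : ℕ) :
    HasSum (fun n : ℕ => binom p (z : ℚ_[p]) n * (-(omegaV p a)⁻¹) ^ n *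
      (∑ k ∈ Finset.range (N + 1), (-1) ^ k * hpow p ((k : ℚ_[p]) + a) ((z - n : ℤ_[p]) : ℚ_[p]) -
        hpow p a ((z - n : ℤ_[p]) : ℚ_[p])))
      (-∑ k ∈ Finset.range N, (-1) ^ k * hpow p ((k : ℚ_[p]) + a) z) := by
  have h := hasSum_sum (s := Finset.range N) fun k _ =>
    (hasSum_hpow_sub_one (b := ((k + 1 : ℕ) : ℚ_[p]) + a)
      (by rwa [norm_add_of_norm_le_one ha (norm_natCast_le_one _)]) z).mul_left ((-1) ^ (k + 1))
  have hval : ∑ k ∈ Finset.range N, (-1) ^ (k + 1) *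
      hpow p (((k + 1 : ℕ) : ℚ_[p]) + a - 1) z =
      -∑ k ∈ Finset.range N, (-1) ^ k * hpow p ((k : ℚ_[p]) + a) z := by
    rw [← Finset.sum_neg_distrib]
    refine Finset.sum_congr rfl fun k _ => ?_
    rw [Nat.cast_succ, add_right_comm, add_sub_cancel_right]
    ring
  rw [← hval]
  refine h.congr_fun fun n => ?_
  rw [Finset.sum_range_succ', pow_zero, one_mul, Nat.cast_zero, zero_add, add_sub_cancel_right,
    Finset.mul_sum]
  refine Finset.sum_congr rfl fun k _ => ?_
  rw [omegaV_add_of_norm_le_one ha (norm_natCast_le_one _)]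
  ring

/-- The terms of the binomial expansion summed against `ζ_{p,E}`. -/
lemma hasSum_zetaE (hodd : p ≠ 2) {a : ℚ_[p]} (ha : 1 < ‖a‖) {s : ℚ_[p]} {z : ℤ_[p]}
    (hz : (z : ℚ_[p]) = 1 - s) :
    HasSum (fun n : ℕ => binom p (1 - s) n * (-(omegaV p a)⁻¹) ^ n *
      (zetaE p (s + n) a - hpow p a (1 - (s + n))))
      (hpow p (a - 1) (1 - s) - zetaE p s a) := by
  have ha0 := ne_zero_of_one_lt_norm ha
  have hzn (n : ℕ) : ((z - n : ℤ_[p]) : ℚ_[p]) = 1 - (s + n) := by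
    rw [PadicInt.coe_sub, hz, PadicInt.coe_natCast]
    ring
  have hka (k : ℕ) : (k : ℚ_[p]) + a ≠ 0 :=
    ne_zero_of_one_lt_norm (by rwa [norm_add_of_norm_le_one ha (norm_natCast_le_one _)])
  let T (r n : ℕ) : ℚ_[p] :=
    ∑ k ∈ Finset.range (p ^ r), (-1) ^ k * hpow p ((k : ℚ_[p]) + a) ((z - n : ℤ_[p]) : ℚ_[p]) -
      hpow p a ((z - n : ℤ_[p]) : ℚ_[p])
  have hT1 (r n : ℕ) : ‖T r n‖ ≤ 1 := by
    refine norm_sub_le_one ?_ (norm_hpow_le_one ha0 _)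
    refine IsUltrametricDist.norm_sum_le_of_forall_le_of_nonneg zero_le_one fun k _ => ?_
    rw [norm_mul, norm_pow, norm_neg, norm_one, one_pow, one_mul]
    exact norm_hpow_le_one (hka k) _
  have hTlim (n : ℕ) : Tendsto (T · n) atTop
      (𝓝 (zetaE p (s + n) a - hpow p a (1 - (s + n)))) := by
    rw [← hzn]
    exact (tendsto_zetaE hodd ha (hzn n)).sub_const _
  have hbound (n : ℕ) {x : ℚ_[p]} (hx : ‖x‖ ≤ 1) :
      ‖binom p (1 - s) n * (-(omegaV p a)⁻¹) ^ n * x‖ ≤ ‖a‖⁻¹ ^ n := by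
    rw [norm_mul, norm_mul, norm_pow, norm_neg, norm_inv, norm_omegaV ha0, ← hz]
    refine (mul_le_of_le_one_right (by positivity) hx).trans
      (mul_le_of_le_one_left (by positivity) (norm_binom_coe_le_one z n))
  have hgeom : Summable fun n : ℕ => ‖a‖⁻¹ ^ n :=
    summable_geometric_of_lt_one (by positivity) (inv_lt_one_of_one_lt₀ ha)
  have hsum : Summable fun n : ℕ => binom p (1 - s) n * (-(omegaV p a)⁻¹) ^ n *
      (zetaE p (s + n) a - hpow p a (1 - (s + n))) :=
    .of_norm_bounded hgeom fun n =>
      hbound n (le_of_tendsto (hTlim n).norm (.of_forall fun r => hT1 r n))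
  have hdom := tendsto_tsum_of_dominated_convergence (𝓕 := atTop) hgeom
    (fun n => (hTlim n).const_mul (binom p (1 - s) n * (-(omegaV p a)⁻¹) ^ n))
    (.of_forall fun r n => hbound n (hT1 r n))
  have hval (r : ℕ) : ∑' n, binom p (1 - s) n * (-(omegaV p a)⁻¹) ^ n * T r n =
      hpow p (((p ^ r : ℕ) : ℚ_[p]) + (a - 1)) z -
        ∑ k ∈ Finset.range (p ^ r), (-1) ^ k * hpow p ((k : ℚ_[p]) + a) z := by
    obtain ⟨N, hN⟩ := Nat.exists_eq_succ_of_ne_zero (pow_ne_zero r (Fact.out : p.Prime).ne_zero)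
    have hev : Even N := by
      have : Odd (p ^ r) := ((Fact.out : p.Prime).odd_of_ne_two hodd).pow
      rw [hN, Nat.succ_eq_add_one, Nat.odd_add_one, Nat.not_odd_iff_even] at this
      exact this
    have h := (hasSum_alternating_sum ha z N).tsum_eq
    simp only [T, hN, ← hz, Nat.succ_eq_add_one]
    rw [h, Finset.sum_range_succ, hev.neg_one_pow, Nat.cast_succ, add_add_sub_cancel]
    ring
  have hlim : Tendsto (fun r : ℕ => hpow p (((p ^ r : ℕ) : ℚ_[p]) + (a - 1)) z) atTop
      (𝓝 (hpow p (a - 1) z)) := by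
    have ha1 : 1 < ‖a - 1‖ := by
      rwa [sub_eq_neg_add, norm_add_of_norm_le_one ha (by simp)]
    rw [← tendsto_sub_nhds_zero_iff]
    refine squeeze_zero_norm (a := fun r => (p : ℝ)⁻¹ ^ r) (fun r => ?_)
      (tendsto_pow_atTop_nhds_zero_of_lt_one (by positivity) inv_prime_lt_one)
    have h := norm_hpow_add_sub_le ha1 (norm_natCast_le_one (p ^ r)) (u := 0) (by simp) z
    rw [zero_add, sub_zero] at h
    refine h.trans_eq ?_
    rw [Nat.cast_pow, norm_pow, Padic.norm_p]
  simp only [hval] at hdom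
  rw [← hz, ← tendsto_nhds_unique hdom (hlim.sub (tendsto_zetaE hodd ha hz)), hz]
  exact hsum.hasSum

lemma binom_one_sub_mul_pow (s a : ℚ_[p]) (n : ℕ) :
    binom p (1 - s) (n + 2) * (-(omegaV p a)⁻¹) ^ (n + 2) = (s - 1) * coeffT p s a (n + 2) := by
  have h : ∏ j ∈ Finset.range (n + 2), (1 - s - (j : ℚ_[p])) =
      (-1) ^ (n + 2) * ((s - 1) * ∏ j ∈ Finset.Icc 1 (n + 1), (s - 1 + (j : ℚ_[p]))) := by
    induction n with
    | zero => simp [Finset.prod_range_succ]; ring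
    | succ n ih =>
      rw [Finset.prod_range_succ, ih, Finset.prod_Icc_succ_top (b := n + 1) (by lia)]
      push_cast
      ring
  have h1 : (-(omegaV p a)⁻¹) ^ (n + 2) = (-1) ^ (n + 2) / omegaV p a ^ (n + 2) := by
    rw [neg_pow, inv_pow, div_eq_mul_inv]
  have h2 : (-1 : ℚ_[p]) ^ (n + 2) * (-1) ^ (n + 2) = 1 := by rw [← mul_pow]; simp
  rw [binom, coeffT, h, h1, div_mul_div_comm, mul_right_comm, h2, one_mul, mul_div_assoc]
  rfl

end Hurwitz

/-- Lemma 1 of the paper: for an odd prime `p`, `s ∈ ℤ_p` with `s ≠ 1` and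
`a ∈ ℚ_p` with `|a|_p > 1`, the series on the left converges `p`-adically and
`(2/(s-1))(ζ_{p,E}(s,a) - ⟨a⟩^{1-s}) + (1/ω_v(a))(ζ_{p,E}(s+1,a) - ⟨a⟩^{-s})
  + ∑_{n≥2} [∏_{j=1}^{n-1}(s-1+j)]/(n! ω_v(a)^n) · (ζ_{p,E}(s+n,a) - ⟨a⟩^{1-(s+n)})
  = (1/(s-1))(⟨a-1⟩^{1-s} - ⟨a⟩^{1-s})`. -/
theorem padic_hurwitz_euler_zeta_identity
    (p : ℕ) [Fact p.Prime] (hodd : p ≠ 2)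
    (s : ℚ_[p]) (hs : ‖s‖ ≤ 1) (hs1 : s ≠ 1)
    (a : ℚ_[p]) (ha : 1 < ‖a‖) :
    Summable (fun n : ℕ =>
      coeffT p s a (n + 2) *
        (zetaE p (s + ((n : ℚ_[p]) + 2)) a - hpow p a (1 - (s + ((n : ℚ_[p]) + 2))))) ∧
    2 / (s - 1) * (zetaE p s a - hpow p a (1 - s)) +
      1 / omegaV p a * (zetaE p (s + 1) a - hpow p a (1 - (s + 1))) +
      ∑' n : ℕ,
        coeffT p s a (n + 2) *
          (zetaE p (s + ((n : ℚ_[p]) + 2)) a - hpow p a (1 - (s + ((n : ℚ_[p]) + 2)))) =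
      1 / (s - 1) * (hpow p (a - 1) (1 - s) - hpow p a (1 - s)) := by
  obtain ⟨z, hz⟩ : ∃ z : ℤ_[p], (z : ℚ_[p]) = 1 - s := by
    refine ⟨⟨1 - s, norm_sub_le_one (by simp) hs⟩, rfl⟩
  have hs0 : s - 1 ≠ 0 := sub_ne_zero.mpr hs1
  have H := hasSum_zetaE hodd ha hz
  have hsum := (summable_nat_add_iff 2).mpr H.summable
  simp only [binom_one_sub_mul_pow, mul_assoc (s - 1)] at hsum
  have htail := H.summable.sum_add_tsum_nat_add 2
  simp only [binom_one_sub_mul_pow, mul_assoc (s - 1), tsum_mul_left] at htail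
  rw [H.tsum_eq] at htail
  push_cast at hsum htail
  refine ⟨(summable_mul_left_iff hs0).mp hsum, ?_⟩
  simp only [Finset.sum_range_succ, Finset.sum_range_zero, binom, Finset.prod_range_succ,
    Finset.prod_range_zero, Nat.factorial, Nat.cast_zero, Nat.cast_one, pow_zero, pow_one,
    add_zero, zero_add, sub_zero, one_mul, mul_one, div_one] at htail
  rw [← mul_right_inj' hs0]
  have e : (s - 1) * (1 / (s - 1)) = 1 := mul_one_div_cancel hs0
  have e2 : (s - 1) * (2 / (s - 1)) = 2 := mul_div_cancel₀ 2 hs0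
  rw [mul_add, mul_add, ← mul_assoc, ← mul_assoc, ← mul_assoc (s - 1) (1 / (s - 1)), e, e2]
  linear_combination htail
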